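/- Let p be a prime with p > 2 and let k be an algebraic closure of the finite field with p elements. Inside the rational function field k(T), the intersection of the two subfields k(T^p + T^{p-1}) and k(T^{p-1}) is k itself; that is, viewing them as intermediate fields of the extension k(T)/k, one has IntermediateField.adjoin k {T^p + T^{p-1}} ⊓ IntermediateField.adjoin k {T^{p-1}} = ⊥. -/

import Mathlib

open Polynomial in
lemma kol_root {k : Type*} [Field k] (p : ℕ) [Fact p.Prime] [CharP k p] [PerfectRing k p]
    (f : k[X]) (hf : derivative f = 0) : ∃ g : k[X], f = g ^ p := by
  refine ⟨(contract p f).map ((frobeniusEquiv k p).symm : k →+* k), ?_⟩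
  rw [← map_frobenius_expand p, ← map_expand, expand_contract p hf (Fact.out : p.Prime).ne_zero,
    Polynomial.map_map]
  have : (frobenius k p).comp ((frobeniusEquiv k p).symm : k →+* k) = RingHom.id k := by
    ext x
    simp
  rw [this, Polynomial.map_id]

open Polynomial in
lemma kol_poly {k : Type*} [Field k] (p : ℕ) [Fact p.Prime] [CharP k p] [PerfectRing k p]
    (hp2 : 2 < p) (n : ℕ) : ∀ P Q : k[X], P.natDegree ≤ n →
      P.comp (X ^ p + X ^ (p - 1)) = Q.comp (X ^ (p - 1)) → ∃ c, P = C c := by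
  have hU : derivative (X ^ p + X ^ (p - 1) : k[X]) = derivative (X ^ (p - 1) : k[X]) := by
    rw [derivative_add, derivative_X_pow, CharP.cast_eq_zero, C_0, zero_mul, zero_add]
  have hVn : (X ^ (p - 1) : k[X]).natDegree = p - 1 := by simp
  have hp1 : ((p - 1 : ℕ) : k) ≠ 0 := by
    rw [Nat.cast_sub (by omega)]
    simp
  have hV0 : derivative (X ^ (p - 1) : k[X]) ≠ 0 := by
    rw [derivative_X_pow]
    exact mul_ne_zero (C_ne_zero.mpr hp1) (pow_ne_zero _ X_ne_zero)
  have hV1 : (derivative (X ^ (p - 1) : k[X])).eval 0 = 0 := by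
    rw [derivative_X_pow]
    simp [show p - 1 - 1 ≠ 0 by omega]
  induction n using Nat.strong_induction_on with
  | _ n ih =>
  intro P Q hP h
  by_cases hn : P.natDegree = 0
  · exact ⟨_, eq_C_of_natDegree_eq_zero hn⟩
  have hd : (derivative P).comp (X ^ p + X ^ (p - 1)) = (derivative Q).comp (X ^ (p - 1)) := by
    have := congrArg derivative h
    rw [derivative_comp, derivative_comp, hU] at this
    exact mul_left_cancel₀ hV0 this
  obtain ⟨c, hc⟩ := ih _ (lt_of_lt_of_le (natDegree_derivative_lt hn) hP) _ _ le_rfl hd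
  have hQ : derivative Q = C c := by
    rw [hc, C_comp] at hd
    have h0 : (derivative Q).natDegree = 0 := by
      have := congrArg natDegree hd
      rw [natDegree_C, natDegree_comp, hVn] at this
      rcases Nat.mul_eq_zero.mp this.symm with h | h
      · exact h
      · omega
    rw [eq_C_of_natDegree_eq_zero h0] at hd ⊢
    rw [C_comp] at hd
    exact hd.symm
  obtain ⟨P1, hP1⟩ := kol_root p (P - C c * X) (by simp [hc])
  obtain ⟨Q1, hQ1⟩ := kol_root p (Q - C c * X) (by simp [hQ])
  obtain ⟨d, hd'⟩ : ∃ d : k, d ^ p = c := by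
    obtain ⟨d, hd⟩ := (frobeniusEquiv k p).surjective c
    exact ⟨d, by simpa [frobenius_def] using hd⟩
  have hP2 : P = P1 ^ p + C c * X := by rw [← hP1]; ring
  have hQ2 : Q = Q1 ^ p + C c * X := by rw [← hQ1]; ring
  have key : P1.comp (X ^ p + X ^ (p - 1)) + C d * X = Q1.comp (X ^ (p - 1)) := by
    apply frobenius_inj k[X] p
    simp only [frobenius_def]
    rw [add_pow_char, mul_pow, ← C_pow, hd']
    rw [hP2, hQ2] at h
    simp only [add_comp, pow_comp, mul_comp, C_comp, X_comp] at h
    linear_combination h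
  have hd0 : d = 0 := by
    have := congrArg (fun f => (derivative f).eval 0) key
    simp only [derivative_add, derivative_comp, hU, eval_add, eval_mul, hV1] at this
    simpa using this
  have hc0 : c = 0 := by rw [← hd', hd0, zero_pow (by omega)]
  rw [hd0, C_0, zero_mul, add_zero] at key
  rw [hc0, C_0, zero_mul, add_zero] at hP2
  have hlt : P1.natDegree < n := by
    have : P.natDegree = p * P1.natDegree := by rw [hP2, natDegree_pow]
    have h1 : P1.natDegree ≠ 0 := by
      intro h; rw [h] at this; omega
    nlinarith [Nat.pos_of_ne_zero h1]
  obtain ⟨e, he⟩ := ih _ hlt _ _ le_rfl key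
  exact ⟨e ^ p, by rw [hP2, he, C_pow]⟩

open Polynomial in
lemma kol_mem {k : Type*} [Field k] (U : k[X]) (x : RatFunc k)
    (hx : x ∈ IntermediateField.adjoin k {algebraMap k[X] (RatFunc k) U}) :
    ∃ r s : k[X], IsCoprime r s ∧ s.comp U ≠ 0 ∧
      x * algebraMap k[X] (RatFunc k) (s.comp U) = algebraMap k[X] (RatFunc k) (r.comp U) := by
  classical
  have ha : ∀ r : k[X], aeval (algebraMap k[X] (RatFunc k) U) r
      = algebraMap k[X] (RatFunc k) (r.comp U) := by
    intro r
    rw [aeval_algebraMap_apply, ← comp_eq_aeval]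
  obtain ⟨r, s, h⟩ := (IntermediateField.mem_adjoin_simple_iff k x).mp hx
  rw [ha, ha] at h
  by_cases hs : s.comp U = 0
  · refine ⟨0, 1, isCoprime_zero_left.mpr isUnit_one, by simp, ?_⟩
    simp [h, hs]
  have hs0 : s ≠ 0 := by rintro rfl; simp at hs
  obtain ⟨r', hr⟩ := EuclideanDomain.gcd_dvd_left r s
  obtain ⟨s', hs'⟩ := EuclideanDomain.gcd_dvd_right r s
  set g := EuclideanDomain.gcd r s with hg
  have hg0 : g ≠ 0 := by intro h0; rw [h0, zero_mul] at hs'; exact hs0 hs'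
  have hco : IsCoprime r' s' := by
    refine ⟨EuclideanDomain.gcdA r s, EuclideanDomain.gcdB r s, ?_⟩
    have := EuclideanDomain.gcd_eq_gcd_ab r s
    rw [← hg] at this
    apply mul_left_cancel₀ hg0
    linear_combination (-1 : k[X]) * this - EuclideanDomain.gcdA r s * hr
      - EuclideanDomain.gcdB r s * hs'
  rw [hs', mul_comp] at hs
  rw [hr, hs', mul_comp, mul_comp, map_mul, map_mul] at h
  have inj := FaithfulSMul.algebraMap_injective k[X] (RatFunc k)
  have h1 : algebraMap k[X] (RatFunc k) (g.comp U) ≠ 0 :=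
    (map_ne_zero_iff _ inj).mpr (left_ne_zero_of_mul hs)
  have h2 : algebraMap k[X] (RatFunc k) (s'.comp U) ≠ 0 :=
    (map_ne_zero_iff _ inj).mpr (right_ne_zero_of_mul hs)
  refine ⟨r', s', hco, right_ne_zero_of_mul hs, ?_⟩
  rw [h]
  field_simp

open Polynomial in
lemma kol_main {k : Type*} [Field k] (p : ℕ) [Fact p.Prime] [CharP k p] [PerfectRing k p]
    (hp2 : 2 < p) :
    (IntermediateField.adjoin k {(RatFunc.X : RatFunc k) ^ p + RatFunc.X ^ (p - 1)}) ⊓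
      (IntermediateField.adjoin k {(RatFunc.X : RatFunc k) ^ (p - 1)}) = ⊥ := by
  rw [eq_bot_iff]
  rintro x ⟨hx1, hx2⟩
  have e1 : (RatFunc.X : RatFunc k) ^ p + RatFunc.X ^ (p - 1)
      = algebraMap k[X] (RatFunc k) (X ^ p + X ^ (p - 1)) := by simp
  have e2 : (RatFunc.X : RatFunc k) ^ (p - 1)
      = algebraMap k[X] (RatFunc k) (X ^ (p - 1)) := by simp
  rw [e1] at hx1
  rw [e2] at hx2
  obtain ⟨a, b, hab, hb, h1⟩ := kol_mem _ x hx1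
  obtain ⟨c, d, hcd, hd, h2⟩ := kol_mem _ x hx2
  have inj := FaithfulSMul.algebraMap_injective k[X] (RatFunc k)
  set U : k[X] := X ^ p + X ^ (p - 1) with hU
  set V : k[X] := X ^ (p - 1) with hV
  have hab' : IsCoprime (a.comp U) (b.comp U) := hab.map (compRingHom U)
  have hcd' : IsCoprime (c.comp V) (d.comp V) := hcd.map (compRingHom V)
  have hE : a.comp U * d.comp V = c.comp V * b.comp U := by
    apply inj
    rw [map_mul, map_mul, ← h1, ← h2]; ring
  have d1 : b.comp U ∣ d.comp V :=
    hab'.symm.dvd_of_dvd_mul_left (hE ▸ dvd_mul_left _ _)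
  have d2 : d.comp V ∣ b.comp U :=
    hcd'.symm.dvd_of_dvd_mul_left (hE ▸ dvd_mul_left _ _)
  obtain ⟨u, hu⟩ := associated_of_dvd_dvd d2 d1
  obtain ⟨l, hl, hl'⟩ := Polynomial.isUnit_iff.mp u.isUnit
  rw [← hl'] at hu
  have hB : b.comp U = (d * C l).comp V := by rw [mul_comp, C_comp, hu]
  have hA : a.comp U = (c * C l).comp V := by
    rw [mul_comp, C_comp]
    apply mul_right_cancel₀ hd
    rw [hE, ← hu]; ring
  obtain ⟨a0, ha0⟩ := kol_poly p hp2 _ a _ le_rfl hA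
  obtain ⟨b0, hb0⟩ := kol_poly p hp2 _ b _ le_rfl hB
  rw [ha0, hb0, C_comp, C_comp] at h1
  rw [hb0, C_comp] at hb
  have hb1 : b0 ≠ 0 := by rintro rfl; simp at hb
  rw [IntermediateField.mem_bot]
  refine ⟨a0 / b0, ?_⟩
  have hb2 : algebraMap k (RatFunc k) b0 ≠ 0 := by simpa using hb1
  rw [map_div₀, div_eq_iff hb2]
  simpa [RatFunc.algebraMap_eq_C] using h1.symm

/-- Kollár's lemma (5.2): over the algebraic closure `k` of `𝔽_p` with `p > 2`,
the intersection of the subfields `k(T^p + T^(p-1))` and `k(T^(p-1))` of `k(T)` is `k`. -/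
theorem stmt_0 (p : ℕ) [Fact p.Prime] (hp2 : 2 < p) :
    (IntermediateField.adjoin (AlgebraicClosure (ZMod p))
        {(RatFunc.X : RatFunc (AlgebraicClosure (ZMod p))) ^ p + RatFunc.X ^ (p - 1)}) ⊓
      (IntermediateField.adjoin (AlgebraicClosure (ZMod p))
        {(RatFunc.X : RatFunc (AlgebraicClosure (ZMod p))) ^ (p - 1)}) = ⊥ := by
  have : CharP (AlgebraicClosure (ZMod p)) p := charP_of_injective_algebraMap' (ZMod p) p
  exact kol_main p hp2
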